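/- Let 𝕂 be a field of characteristic zero, let p(z) = c z^k with c ∈ 𝕂 nonzero and k ≥ 1, and let q_+, q_- ∈ 𝕂 be nonzero. Then the elements x_+ and x_- are units of A(p;q_±), and for every n ∈ ℤ the degree-n component of A(p;q_±)^{(k)} contains a unit and is isomorphic to the degree-zero component as a left module over the degree-zero component. -/

import Mathlib

set_option synthInstance.maxHeartbeats 1000000
set_option maxHeartbeats 1000000

open Polynomial FreeAlgebra

noncomputable section

variable (𝕂 : Type) [Field 𝕂]

/-- The defining relations of the algebra `A(p;q±)`: generator `0` is `z₊`, `1` is `z₋`,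
`2` is `x₊`, `3` is `x₋`; `pt` is the polynomial `p̃` with `p(z) = z^k p̃(z)`. -/
inductive ARel (pt : Polynomial 𝕂) (qp qm : 𝕂) :
    FreeAlgebra 𝕂 (Fin 4) → FreeAlgebra 𝕂 (Fin 4) → Prop
  | comm : ARel pt qp qm (ι 𝕂 0 * ι 𝕂 1) (ι 𝕂 1 * ι 𝕂 0)
  | pm : ARel pt qp qm (ι 𝕂 2 * ι 𝕂 3) (aeval (ι 𝕂 0 * ι 𝕂 1) pt)
  | mp : ARel pt qp qm (ι 𝕂 3 * ι 𝕂 2) (aeval ((qp * qm) • (ι 𝕂 0 * ι 𝕂 1)) pt)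
  | pzp : ARel pt qp qm (ι 𝕂 2 * ι 𝕂 0) (qp⁻¹ • (ι 𝕂 0 * ι 𝕂 2))
  | pzm : ARel pt qp qm (ι 𝕂 2 * ι 𝕂 1) (qm⁻¹ • (ι 𝕂 1 * ι 𝕂 2))
  | mzp : ARel pt qp qm (ι 𝕂 3 * ι 𝕂 0) (qp • (ι 𝕂 0 * ι 𝕂 3))
  | mzm : ARel pt qp qm (ι 𝕂 3 * ι 𝕂 1) (qm • (ι 𝕂 1 * ι 𝕂 3))

/-- The algebra `A(p;q±)`, presented by generators and relations. -/
abbrev APM (pt : Polynomial 𝕂) (qp qm : 𝕂) : Type := RingQuot (ARel 𝕂 pt qp qm)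

variable {𝕂}

/-- The generators of `A(p;q±)`: `gen 0 = z₊`, `gen 1 = z₋`, `gen 2 = x₊`, `gen 3 = x₋`. -/
def gen (pt : Polynomial 𝕂) (qp qm : 𝕂) (i : Fin 4) : APM 𝕂 pt qp qm :=
  RingQuot.mkAlgHom 𝕂 (ARel 𝕂 pt qp qm) (ι 𝕂 i)

/-- The degrees of the generators: `deg z₊ = 1`, `deg z₋ = -1`, `deg x₊ = k`, `deg x₋ = -k`. -/
def gdeg (k : ℕ) : Fin 4 → ℤ := ![1, -1, (k : ℤ), -(k : ℤ)]

/-- The degree-`n` component of the ℤ-grading of `A(p;q±)`: the span of the images of the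
monomials in the generators of total degree `n`. -/
def acomp (pt : Polynomial 𝕂) (qp qm : 𝕂) (k : ℕ) (n : ℤ) : Submodule 𝕂 (APM 𝕂 pt qp qm) :=
  Submodule.span 𝕂
    {a | ∃ l : List (Fin 4), (l.map (gdeg k)).sum = n ∧ a = (l.map (gen pt qp qm)).prod}


theorem acomp_one_mem (pt : Polynomial 𝕂) (qp qm : 𝕂) (k : ℕ) :
    (1 : APM 𝕂 pt qp qm) ∈ acomp pt qp qm k 0 :=
  Submodule.subset_span ⟨[], by simp, by simp⟩

theorem acomp_mul_le (pt : Polynomial 𝕂) (qp qm : 𝕂) (k : ℕ) (m n : ℤ) :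
    acomp pt qp qm k m * acomp pt qp qm k n ≤ acomp pt qp qm k (m + n) := by
  rw [acomp, acomp, Submodule.span_mul_span]
  apply Submodule.span_mono
  rw [Set.mul_subset_iff]
  rintro _ ⟨l1, h1, rfl⟩ _ ⟨l2, h2, rfl⟩
  exact ⟨l1 ++ l2, by simp [h1, h2], by simp⟩

/-- The degree-zero part of the `k`-th Veronese subalgebra of `A(p;q±)`
(equivalently, the degree-zero part of `A(p;q±)`), as a subalgebra. -/
def A0 (pt : Polynomial 𝕂) (qp qm : 𝕂) (k : ℕ) : Subalgebra 𝕂 (APM 𝕂 pt qp qm) where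
  carrier := acomp pt qp qm k 0
  mul_mem' := fun ha hb => by
    simpa using acomp_mul_le pt qp qm k 0 0 (Submodule.mul_mem_mul ha hb)
  one_mem' := acomp_one_mem pt qp qm k
  add_mem' := fun ha hb => add_mem ha hb
  zero_mem' := zero_mem _
  algebraMap_mem' := fun c => by
    rw [Algebra.algebraMap_eq_smul_one]
    exact Submodule.smul_mem _ _ (acomp_one_mem pt qp qm k)

/-- The degree-`n` component of the `k`-th Veronese subalgebra of `A(p;q±)`, viewed as a
left module over the degree-zero part `A0`. -/
def VN (pt : Polynomial 𝕂) (qp qm : 𝕂) (k : ℕ) (n : ℤ) :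
    Submodule (A0 pt qp qm k) (APM 𝕂 pt qp qm) where
  carrier := acomp pt qp qm k (n * k)
  add_mem' := fun ha hb => add_mem ha hb
  zero_mem' := zero_mem _
  smul_mem' := fun c x hx => by
    show (c : APM 𝕂 pt qp qm) * x ∈ _
    simpa using acomp_mul_le pt qp qm k 0 (n * k) (Submodule.mul_mem_mul c.2 hx)

theorem gen_mem_acomp (pt : Polynomial 𝕂) (qp qm : 𝕂) (k : ℕ) (i : Fin 4) :
    gen pt qp qm i ∈ acomp pt qp qm k (gdeg k i) :=
  Submodule.subset_span ⟨[i], by simp, by simp⟩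

theorem acomp_mul_mem {pt : Polynomial 𝕂} {qp qm : 𝕂} {k : ℕ} {m n : ℤ} {a b : APM 𝕂 pt qp qm}
    (ha : a ∈ acomp pt qp qm k m) (hb : b ∈ acomp pt qp qm k n) :
    a * b ∈ acomp pt qp qm k (m + n) :=
  acomp_mul_le pt qp qm k m n (Submodule.mul_mem_mul ha hb)

theorem acomp_pow_mem {pt : Polynomial 𝕂} {qp qm : 𝕂} {k : ℕ} {m : ℤ} {a : APM 𝕂 pt qp qm}
    (ha : a ∈ acomp pt qp qm k m) (n : ℕ) : a ^ n ∈ acomp pt qp qm k (n * m) := by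
  induction n with
  | zero => simpa using acomp_one_mem pt qp qm k
  | succ n ih =>
    rw [pow_succ, Nat.cast_succ, add_one_mul]
    exact acomp_mul_mem ih ha

theorem acomp_zpow_mem {pt : Polynomial 𝕂} {qp qm : 𝕂} {k : ℕ} {m : ℤ} {u : (APM 𝕂 pt qp qm)ˣ}
    (hu : (u : APM 𝕂 pt qp qm) ∈ acomp pt qp qm k m)
    (hu' : ((u⁻¹ : (APM 𝕂 pt qp qm)ˣ) : APM 𝕂 pt qp qm) ∈ acomp pt qp qm k (-m)) (n : ℤ) :
    ((u ^ n : (APM 𝕂 pt qp qm)ˣ) : APM 𝕂 pt qp qm) ∈ acomp pt qp qm k (n * m) := by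
  obtain ⟨n, rfl | rfl⟩ := n.eq_nat_or_neg
  · rw [zpow_natCast, Units.val_pow_eq_pow_val]
    exact acomp_pow_mem hu n
  · rw [zpow_neg, ← inv_zpow, zpow_natCast, Units.val_pow_eq_pow_val, neg_mul_comm]
    exact acomp_pow_mem hu' n

theorem gen_two_mul_gen_three (c qp qm : 𝕂) :
    gen (C c) qp qm 2 * gen (C c) qp qm 3 = algebraMap 𝕂 _ c := by
  rw [gen, gen, ← map_mul, RingQuot.mkAlgHom_rel 𝕂 ARel.pm, aeval_C, AlgHom.commutes]

theorem gen_three_mul_gen_two (c qp qm : 𝕂) :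
    gen (C c) qp qm 3 * gen (C c) qp qm 2 = algebraMap 𝕂 _ c := by
  rw [gen, gen, ← map_mul, RingQuot.mkAlgHom_rel 𝕂 ARel.mp, aeval_C, AlgHom.commutes]

/-- For constant `p̃ = c ≠ 0`, the generator `x₊` as a unit, with inverse `c⁻¹ x₋`. -/
def xPlusUnit {c : 𝕂} (hc : c ≠ 0) (qp qm : 𝕂) : (APM 𝕂 (C c) qp qm)ˣ where
  val := gen (C c) qp qm 2
  inv := c⁻¹ • gen (C c) qp qm 3
  val_inv := by
    rw [mul_smul_comm, gen_two_mul_gen_three, Algebra.algebraMap_eq_smul_one, inv_smul_smul₀ hc]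
  inv_val := by
    rw [smul_mul_assoc, gen_three_mul_gen_two, Algebra.algebraMap_eq_smul_one, inv_smul_smul₀ hc]

/-- Right multiplication by a homogeneous unit of degree `m * k` whose inverse is homogeneous of
degree `-(m * k)` identifies the degree-`n` and degree-`n + m` components. -/
def VN.mulRightEquiv {pt : Polynomial 𝕂} {qp qm : 𝕂} {k : ℕ} {m : ℤ} (u : (APM 𝕂 pt qp qm)ˣ)
    (hu : (u : APM 𝕂 pt qp qm) ∈ acomp pt qp qm k (m * k))
    (hu' : ((u⁻¹ : (APM 𝕂 pt qp qm)ˣ) : APM 𝕂 pt qp qm) ∈ acomp pt qp qm k (-(m * k))) (n : ℤ) :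
    VN pt qp qm k n ≃ₗ[A0 pt qp qm k] VN pt qp qm k (n + m) where
  toFun a := ⟨a * u, by
    have h := acomp_mul_mem a.2 hu
    rwa [← add_mul] at h⟩
  invFun a := ⟨a * (u⁻¹ : (APM 𝕂 pt qp qm)ˣ), by
    have h := acomp_mul_mem a.2 hu'
    rwa [← sub_eq_add_neg, ← sub_mul, add_sub_cancel_right] at h⟩
  map_add' a b := Subtype.ext (add_mul _ _ _)
  map_smul' r a := Subtype.ext (mul_assoc _ _ _)
  left_inv a := Subtype.ext (u.mul_inv_cancel_right _)
  right_inv a := Subtype.ext (u.inv_mul_cancel_right _)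

/-- if `p(z) = c z^k` with `c ≠ 0` (so `p̃ = c`), then `x₊` and `x₋` are units of
`A(p;q±)`, and every component of the `k`-th Veronese subalgebra contains a unit and is
isomorphic, as a left module over the degree-zero part, to the degree-zero component. -/
theorem stmt9 [CharZero 𝕂] (c : 𝕂) (hc : c ≠ 0) (p : Polynomial 𝕂) (k : ℕ) (hk : 1 ≤ k)
    (hpfac : p = Polynomial.C c * Polynomial.X ^ k)
    (qp qm : 𝕂) (hqp : qp ≠ 0) (hqm : qm ≠ 0) :
    IsUnit (gen (Polynomial.C c) qp qm 2) ∧ IsUnit (gen (Polynomial.C c) qp qm 3) ∧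
      ∀ n : ℤ,
        (∃ u : (APM 𝕂 (Polynomial.C c) qp qm)ˣ,
          (u : APM 𝕂 (Polynomial.C c) qp qm) ∈ acomp (Polynomial.C c) qp qm k (n * k)) ∧
        Nonempty
          (VN (Polynomial.C c) qp qm k n ≃ₗ[A0 (Polynomial.C c) qp qm k]
            VN (Polynomial.C c) qp qm k 0) := by
  let u := xPlusUnit hc qp qm
  have hz := acomp_zpow_mem (u := u) (gen_mem_acomp (C c) qp qm k 2)
    (Submodule.smul_mem _ _ (gen_mem_acomp (C c) qp qm k 3))
  have hu3 : gen (C c) qp qm 3 = c • ((u⁻¹ : (APM 𝕂 (C c) qp qm)ˣ) : APM 𝕂 (C c) qp qm) :=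
    (smul_inv_smul₀ hc _).symm
  refine ⟨u.isUnit, ?_, fun n => ⟨⟨u ^ n, hz n⟩, ?_⟩⟩
  · rw [hu3, Algebra.smul_def]
    exact (hc.isUnit.map (algebraMap 𝕂 _)).mul u⁻¹.isUnit
  · have hn := hz (-n)
    have hn' := hz n
    rw [← neg_neg n, zpow_neg, neg_mul] at hn'
    have e := VN.mulRightEquiv (u ^ (-n)) hn hn' n
    rw [add_neg_cancel] at e
    exact ⟨e⟩

end
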